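/- arXiv:1607.00289 — 3 statements merged into one kernel-verified Lean document; each statement's English description precedes it below -/
import Mathlib

section
/- Let T : H₁ → H₂ be an unbounded, densely defined, closed operator between separable Hilbert spaces with closed range. Then the Green operator of T* ∘ T satisfies G_{T*∘T} = G_T ∘ G_{T*}. -/
namespace Paper

/-- Composition `S ∘ T` of partially defined (unbounded) linear maps, with domain
`{x ∈ dom T | T x ∈ dom S}` and value `S (T x)`. -/
noncomputable def pcomp {R E F G : Type*} [Ring R] [AddCommGroup E] [Module R E]
    [AddCommGroup F] [Module R F] [AddCommGroup G] [Module R G]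
    (S : F →ₗ.[R] G) (T : E →ₗ.[R] F) : E →ₗ.[R] G where
  domain := (S.domain.comap T.toFun).map T.domain.subtype
  toFun :=
    (S.toFun.comp (((T.toFun.comp (S.domain.comap T.toFun).subtype)).codRestrict S.domain
      fun c => c.2)).comp
      (Submodule.equivMapOfInjective T.domain.subtype (Submodule.injective_subtype T.domain)
        (S.domain.comap T.toFun)).symm.toLinearMap
/-- The range (image) of a partially defined linear map. -/
def pran {R E F : Type*} [Ring R] [AddCommGroup E] [Module R E] [AddCommGroup F] [Module R F]
    (T : E →ₗ.[R] F) : Set F :=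
  Set.range fun x : T.domain => T x

/-- The kernel of a partially defined linear map, as a subset of the ambient space. -/
def pker {R E F : Type*} [Ring R] [AddCommGroup E] [Module R E] [AddCommGroup F] [Module R F]
    (T : E →ₗ.[R] F) : Set E :=
  {x | ∃ h : x ∈ T.domain, T ⟨x, h⟩ = 0}
/-- `G` is the Green operator of the closed densely defined operator `T` (with closed range):
`G` vanishes on `ker T†`, and on `im T` it takes values in `dom T ∩ im T†` and is a right
inverse of `T`. -/
def IsGreen {E F : Type*} [NormedAddCommGroup E] [InnerProductSpace ℂ E] [CompleteSpace E]
    [NormedAddCommGroup F] [InnerProductSpace ℂ F] [CompleteSpace F]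
    (T : E →ₗ.[ℂ] F) (G : F →L[ℂ] E) : Prop :=
  (∀ u : T.adjoint.domain, T.adjoint u = 0 → G (u : F) = 0) ∧
  ∀ u : T.domain, ∃ h : G (T u) ∈ T.domain,
    G (T u) ∈ pran T.adjoint ∧ T ⟨G (T u), h⟩ = T u

theorem pcomp_intro {R E F G : Type*} [Ring R] [AddCommGroup E] [Module R E]
    [AddCommGroup F] [Module R F] [AddCommGroup G] [Module R G]
    (S : F →ₗ.[R] G) (T : E →ₗ.[R] F) (x : T.domain) (h : T x ∈ S.domain) :
    ∃ h' : (x : E) ∈ (pcomp S T).domain, pcomp S T ⟨x, h'⟩ = S ⟨T x, h⟩ := by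
  have h' : (x : E) ∈ (pcomp S T).domain := ⟨x, h, rfl⟩
  refine ⟨h', ?_⟩
  have key : (Submodule.equivMapOfInjective T.domain.subtype
      (Submodule.injective_subtype T.domain) (S.domain.comap T.toFun)).symm ⟨x, h'⟩
      = ⟨x, h⟩ := by
    rw [LinearEquiv.symm_apply_eq]
    rfl
  change (S.toFun.comp (((T.toFun.comp (S.domain.comap T.toFun).subtype)).codRestrict S.domain
      fun c => c.2)) ((Submodule.equivMapOfInjective T.domain.subtype
      (Submodule.injective_subtype T.domain) (S.domain.comap T.toFun)).symm ⟨x, h'⟩) = _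
  rw [key]
  rfl

theorem pcomp_elim {R E F G : Type*} [Ring R] [AddCommGroup E] [Module R E]
    [AddCommGroup F] [Module R F] [AddCommGroup G] [Module R G]
    (S : F →ₗ.[R] G) (T : E →ₗ.[R] F) (y : (pcomp S T).domain) :
    ∃ (x : T.domain) (h : T x ∈ S.domain), (x : E) = y ∧ pcomp S T y = S ⟨T x, h⟩ := by
  obtain ⟨y, x, h, rfl⟩ := y
  obtain ⟨h', e⟩ := pcomp_intro S T x h
  exact ⟨x, h, rfl, e⟩

section
variable {E F : Type*} [NormedAddCommGroup E] [InnerProductSpace ℂ E] [CompleteSpace E]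
    [NormedAddCommGroup F] [InnerProductSpace ℂ F] [CompleteSpace F]

theorem pran_adj_orth (S : E →ₗ.[ℂ] F) (w : E) (hw : w ∈ pran S.adjoint)
    (k : S.domain) (hk : S k = 0) : inner ℂ w (k : E) = 0 := by
  obtain ⟨s, rfl⟩ := hw
  by_cases hd : Dense (S.domain : Set E)
  · have := LinearPMap.adjoint_isFormalAdjoint hd s k
    rw [hk, inner_zero_right] at this
    exact this
  · simp [LinearPMap.adjoint_apply_of_not_dense hd]

theorem adj_ker (S : E →ₗ.[ℂ] F) (u : F) (hu : ∀ x : S.domain, inner ℂ u (S x) = 0) :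
    ∃ h : u ∈ S.adjoint.domain, S.adjoint ⟨u, h⟩ = 0 := by
  have h : u ∈ S.adjoint.domain :=
    LinearPMap.mem_adjoint_domain_of_exists u ⟨0, fun x => by rw [hu, inner_zero_left]⟩
  refine ⟨h, ?_⟩
  by_cases hd : Dense (S.domain : Set E)
  · exact LinearPMap.adjoint_apply_eq hd _ fun x => by rw [inner_zero_left]; exact (hu x).symm
  · exact LinearPMap.adjoint_apply_of_not_dense hd _
end

/-- For an unbounded, densely defined, closed operator `T : H₁ → H₂` between
separable Hilbert spaces with closed range, the Green operator of `T† ∘ T` satisfies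
`G_{T†∘T} = G_T ∘ G_{T†}`. -/
theorem stmt1 {H₁ H₂ : Type*}
    [NormedAddCommGroup H₁] [InnerProductSpace ℂ H₁] [CompleteSpace H₁]
    [TopologicalSpace.SeparableSpace H₁]
    [NormedAddCommGroup H₂] [InnerProductSpace ℂ H₂] [CompleteSpace H₂]
    [TopologicalSpace.SeparableSpace H₂]
    (T : H₁ →ₗ.[ℂ] H₂) (hdense : Dense (T.domain : Set H₁)) (hclosed : T.IsClosed)
    (hran : IsClosed (pran T))
    (GT : H₂ →L[ℂ] H₁) (hGT : IsGreen T GT)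
    (GTs : H₁ →L[ℂ] H₂) (hGTs : IsGreen T.adjoint GTs)
    (G : H₁ →L[ℂ] H₁) (hG : IsGreen (pcomp T.adjoint T) G) :
    G = GT.comp GTs := by
  have hfa := LinearPMap.adjoint_isFormalAdjoint hdense
  let K : Submodule ℂ H₁ := (LinearMap.ker T.toFun).map T.domain.subtype
  let N : Submodule ℂ H₁ := LinearMap.ker ((G - GT.comp GTs : H₁ →L[ℂ] H₁) : H₁ →ₗ[ℂ] H₁)
  have hNc : IsClosed (N : Set H₁) := (G - GT.comp GTs).isClosed_ker
  have memN : ∀ x, x ∈ N ↔ G x = GT (GTs x) := fun x => by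
    simp [N, LinearMap.mem_ker, sub_eq_zero]
  have hKN : K ≤ N := by
    rintro _ ⟨k, hk, rfl⟩
    have hk' : T k = 0 := hk
    rw [memN]
    obtain ⟨h1, e1⟩ := adj_ker T.adjoint (k : H₁) fun x => by
      rw [← inner_conj_symm, hfa x k, hk']; simp
    obtain ⟨h2, e2⟩ := adj_ker (pcomp T.adjoint T) (k : H₁) fun x => by
      obtain ⟨x', h, -, e⟩ := pcomp_elim T.adjoint T x
      rw [e, ← inner_conj_symm, hfa _ k, hk']; simp
    have a1 : GTs (k : H₁) = 0 := hGTs.1 _ e1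
    have a2 : G (k : H₁) = 0 := hG.1 _ e2
    change G (k : H₁) = GT (GTs (k : H₁))
    rw [a1, a2, map_zero]
  have hKoN : Kᗮ ≤ N := by
    intro y hy
    rw [memN]
    have hyK : ∀ k : T.domain, T k = 0 → inner ℂ y (k : H₁) = 0 := fun k hk =>
      (Submodule.mem_orthogonal' K y).1 hy _ ⟨k, hk, rfl⟩
    -- `y` lies in the range of the adjoint
    have hz : ∀ u : T.domain, inner ℂ y (u : H₁) =
        inner ℂ (ContinuousLinearMap.adjoint GT y) (T u) := by
      intro u
      rw [ContinuousLinearMap.adjoint_inner_left]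
      obtain ⟨h, -, e⟩ := hGT.2 u
      have := hyK (u - ⟨GT (T u), h⟩) (by rw [LinearPMap.map_sub, e, sub_self])
      rw [Submodule.coe_sub, inner_sub_right, sub_eq_zero] at this
      exact this
    have hzd : ContinuousLinearMap.adjoint GT y ∈ T.adjoint.domain :=
      LinearPMap.mem_adjoint_domain_of_exists _ ⟨y, hz⟩
    have hzy : T.adjoint ⟨_, hzd⟩ = y := LinearPMap.adjoint_apply_eq hdense _ hz
    obtain ⟨hw, hwr, hwe⟩ := hGTs.2 ⟨_, hzd⟩
    simp only [hzy] at hw hwr hwe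
    have hwT : GTs y ∈ LinearMap.range T.toFun := by
      have hc : IsClosed ((LinearMap.range T.toFun : Submodule ℂ H₂) : Set H₂) := by
        have e : ((LinearMap.range T.toFun : Submodule ℂ H₂) : Set H₂) = pran T := rfl
        rw [e]; exact hran
      haveI : CompleteSpace (LinearMap.range T.toFun : Submodule ℂ H₂) :=
        hc.completeSpace_coe
      rw [← Submodule.orthogonal_orthogonal (LinearMap.range T.toFun),
        Submodule.mem_orthogonal']
      intro u hu
      obtain ⟨h1, e1⟩ := adj_ker T u fun x =>
        (Submodule.mem_orthogonal' _ u).1 hu _ ⟨x, rfl⟩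
      exact pran_adj_orth T.adjoint _ hwr ⟨u, h1⟩ e1
    obtain ⟨x, hx⟩ := hwT
    have hx' : T x = GTs y := hx
    obtain ⟨hv, hvr, hve⟩ := hGT.2 x
    simp only [hx'] at hv hvr hve
    obtain ⟨hvA, hvAe⟩ := pcomp_intro T.adjoint T ⟨GT (GTs y), hv⟩ (by rw [hve]; exact hw)
    have hAv : pcomp T.adjoint T ⟨GT (GTs y), hvA⟩ = y := by
      rw [hvAe]
      simp only [hve]
      exact hwe
    obtain ⟨hg, hgr, hge⟩ := hG.2 ⟨_, hvA⟩
    simp only [hAv] at hg hgr hge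
    obtain ⟨g, hgd, hgg, hgA⟩ := pcomp_elim T.adjoint T ⟨_, hg⟩
    rw [hge] at hgA
    have hgg' : (g : H₁) = G y := hgg
    -- the difference lies in the kernel of `T`
    have hTd : T (g - ⟨GT (GTs y), hv⟩) = 0 := by
      have hmem : T (g - ⟨GT (GTs y), hv⟩) ∈ T.adjoint.domain := by
        rw [LinearPMap.map_sub, hve]
        exact T.adjoint.domain.sub_mem hgd hw
      have hz0 : T.adjoint ⟨_, hmem⟩ = 0 := by
        have : (⟨_, hmem⟩ : T.adjoint.domain) = ⟨T g, hgd⟩ - ⟨GTs y, hw⟩ := by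
          apply Subtype.ext
          simp only [LinearPMap.map_sub, hve]
          rfl
        rw [this, LinearPMap.map_sub, ← hgA, hwe, sub_self]
      have := hfa ⟨_, hmem⟩ (g - ⟨GT (GTs y), hv⟩)
      rw [hz0, inner_zero_left] at this
      exact inner_self_eq_zero.1 this.symm
    have o1 := pran_adj_orth T _ hvr _ hTd
    have o2 : inner ℂ (G y) ((g - ⟨GT (GTs y), hv⟩ : T.domain) : H₁) = 0 := by
      obtain ⟨hd, hde⟩ := pcomp_intro T.adjoint T (g - ⟨GT (GTs y), hv⟩)
        (by rw [hTd]; exact T.adjoint.domain.zero_mem)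
      refine pran_adj_orth (pcomp T.adjoint T) _ hgr ⟨_, hd⟩ ?_
      rw [hde]
      simp only [hTd]
      exact LinearPMap.map_zero _
    rw [Submodule.coe_sub, hgg'] at o1 o2
    have o3 : inner ℂ (G y - GT (GTs y)) (G y - GT (GTs y)) = 0 := by
      rw [inner_sub_left, o2, o1, sub_zero]
    exact sub_eq_zero.1 (inner_self_eq_zero.1 o3)
  haveI : CompleteSpace N := hNc.completeSpace_coe
  have hNt : N = ⊤ := by
    rw [← Submodule.orthogonal_eq_bot_iff, eq_bot_iff]
    intro x hx
    have hxN : x ∈ N := hKoN (Submodule.orthogonal_le hKN hx)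
    exact inner_self_eq_zero.1 ((Submodule.mem_orthogonal N x).1 hx x hxN)
  ext x
  exact (memN x).1 (hNt ▸ Submodule.mem_top)

end Paper
end

section
/- In the setting of a Hilbert complex with two closed-range operators T₁ : H₁ → H₂, T₂ : H₂ → H₃ (closed, densely defined, with im(T₁) ⊆ ker(T₂)), the Laplacian Δ_T = T₁∘T₁* + T₂*∘T₂ on H₂ has closed range. -/
namespace Paper

theorem mem_pcomp_domain {R E F G : Type*} [Ring R] [AddCommGroup E] [Module R E]
    [AddCommGroup F] [Module R F] [AddCommGroup G] [Module R G]
    (S : F →ₗ.[R] G) (T : E →ₗ.[R] F) (x : E) :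
    x ∈ (pcomp S T).domain ↔ ∃ h : x ∈ T.domain, T ⟨x, h⟩ ∈ S.domain := by
  constructor
  · rintro ⟨y, hy, rfl⟩
    exact ⟨y.2, hy⟩
  · rintro ⟨h, h'⟩
    exact ⟨⟨x, h⟩, h', rfl⟩

theorem pcomp_apply {R E F G : Type*} [Ring R] [AddCommGroup E] [Module R E]
    [AddCommGroup F] [Module R F] [AddCommGroup G] [Module R G]
    (S : F →ₗ.[R] G) (T : E →ₗ.[R] F) (x : E) (hx : x ∈ (pcomp S T).domain)
    (h : x ∈ T.domain) (h' : T ⟨x, h⟩ ∈ S.domain) :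
    pcomp S T ⟨x, hx⟩ = S ⟨T ⟨x, h⟩, h'⟩ := by
  have key : (Submodule.equivMapOfInjective T.domain.subtype
      (Submodule.injective_subtype T.domain) (S.domain.comap T.toFun)).symm ⟨x, hx⟩
      = ⟨⟨x, h⟩, h'⟩ := by
    rw [LinearEquiv.symm_apply_eq]
    rfl
  change S.toFun ⟨T.toFun ((Submodule.equivMapOfInjective T.domain.subtype
      (Submodule.injective_subtype T.domain) (S.domain.comap T.toFun)).symm ⟨x, hx⟩ :
      S.domain.comap T.toFun), _⟩ = _
  simp only [key]
  rfl

section aux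
variable {E F : Type*} [NormedAddCommGroup E] [InnerProductSpace ℂ E] [CompleteSpace E]
  [NormedAddCommGroup F] [InnerProductSpace ℂ F] [CompleteSpace F]

theorem adj_mem {T : E →ₗ.[ℂ] F} (hd : Dense (T.domain : Set E)) (y : F) (w : E)
    (hw : ∀ x : T.domain, inner ℂ w (x : E) = inner ℂ y (T x)) :
    ∃ h : y ∈ T.adjoint.domain, T.adjoint ⟨y, h⟩ = w :=
  ⟨LinearPMap.mem_adjoint_domain_of_exists y ⟨w, hw⟩,
    LinearPMap.adjoint_apply_eq hd _ hw⟩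

/-- the kernel as a submodule -/
def kerS (T : E →ₗ.[ℂ] F) : Submodule ℂ E := T.graph.comap (LinearMap.inl ℂ E F)

theorem mem_kerS (T : E →ₗ.[ℂ] F) (x : E) :
    x ∈ kerS T ↔ ∃ h : x ∈ T.domain, T ⟨x, h⟩ = 0 := by
  simp only [kerS, Submodule.mem_comap, LinearMap.inl_apply, LinearPMap.mem_graph_iff]
  constructor
  · rintro ⟨y, rfl, h⟩
    exact ⟨y.2, h⟩
  · rintro ⟨h, h'⟩
    exact ⟨⟨x, h⟩, rfl, h'⟩

theorem kerS_closed {T : E →ₗ.[ℂ] F} (hc : T.IsClosed) : IsClosed (kerS T : Set E) := by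
  have : Continuous (fun x : E => ((x, 0) : E × F)) := by fun_prop
  exact IsClosed.preimage this hc

theorem exists_perp {T : E →ₗ.[ℂ] F} (hc : T.IsClosed) (z : T.domain) :
    ∃ z' : T.domain, T z' = T z ∧ (z' : E) ∈ (kerS T)ᗮ := by
  haveI : CompleteSpace (kerS T) := (kerS_closed hc).completeSpace_coe
  obtain ⟨a, ha, b, hb, hab⟩ := (kerS T).exists_add_mem_mem_orthogonal (z : E)
  obtain ⟨h, h0⟩ := (mem_kerS T a).1 ha
  refine ⟨z - ⟨a, h⟩, ?_, ?_⟩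
  · rw [LinearPMap.map_sub, h0, sub_zero]
  · have : ((z - ⟨a, h⟩ : T.domain) : E) = b := by
      simp [hab]
    rw [this]; exact hb

theorem crt {T : E →ₗ.[ℂ] F} (hd : Dense (T.domain : Set E)) (hc : T.IsClosed)
    (hr : IsClosed (pran T)) (x : E) (hx : x ∈ (kerS T)ᗮ) :
    ∃ z : T.domain, T z ∈ T.adjoint.domain ∧
      ∃ h : T z ∈ T.adjoint.domain, T.adjoint ⟨T z, h⟩ = x := by
  let R : Submodule ℂ F := LinearMap.range T.toFun
  have hR : IsClosed (R : Set F) := hr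
  haveI : CompleteSpace R := hR.completeSpace_coe
  haveI : CompleteSpace T.graph := IsClosed.completeSpace_coe (hs := hc)
  have hmem : ∀ p : T.graph, ∃ z : T.domain, (z : E) = p.1.1 ∧ T z = p.1.2 := fun p =>
    (LinearPMap.mem_graph_iff T).1 p.2
  let A : T.graph →L[ℂ] R :=
    ((ContinuousLinearMap.snd ℂ E F).comp T.graph.subtypeL).codRestrict R (by
      intro p
      obtain ⟨z, -, h⟩ := hmem p
      exact ⟨z, h⟩)
  have hA : ∀ p, ((A p : R) : F) = p.1.2 := fun p => rfl
  have hs : Function.Surjective A := by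
    rintro ⟨_, z, rfl⟩
    exact ⟨⟨((z : E), T z), LinearPMap.mem_graph T z⟩, rfl⟩
  obtain ⟨C, hC, hCb⟩ := A.exists_preimage_norm_le hs
  obtain ⟨g, hg⟩ := A.toLinearMap.exists_rightInverse_of_surjective
    (LinearMap.range_eq_top.2 hs)
  have hg' : ∀ r, A (g r) = r := fun r => LinearMap.congr_fun hg r
  have hwd : ∀ p q : T.graph, A p = A q → inner ℂ x p.1.1 = inner ℂ x q.1.1 := by
    intro p q h
    have h2 : (p - q).1.2 = 0 := by
      rw [← hA, map_sub, h, sub_self]; rfl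
    obtain ⟨z, hz, hz'⟩ := hmem (p - q)
    have : (p - q).1.1 ∈ kerS T := by
      rw [← hz]
      exact (mem_kerS T _).2 ⟨z.2, by rw [← h2, ← hz']⟩
    have h3 := (Submodule.mem_orthogonal' _ _).1 hx _ this
    have h4 : (p - q).1.1 = p.1.1 - q.1.1 := rfl
    rw [h4, inner_sub_right, sub_eq_zero] at h3
    exact h3
  let φ₀ : R →ₗ[ℂ] ℂ := (innerSL ℂ x).toLinearMap ∘ₗ (LinearMap.fst ℂ E F) ∘ₗ
    T.graph.subtype ∘ₗ g
  have hφ₀ : ∀ r, φ₀ r = inner ℂ x (g r).1.1 := fun r => rfl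
  let φ : R →L[ℂ] ℂ := φ₀.mkContinuous (‖x‖ * C) (by
    intro r
    obtain ⟨p, hp, hpn⟩ := hCb r
    rw [hφ₀, hwd (g r) p (by rw [hg', hp])]
    calc ‖inner ℂ x p.1.1‖ ≤ ‖x‖ * ‖p.1.1‖ := norm_inner_le_norm _ _
      _ ≤ ‖x‖ * ‖p‖ := by gcongr; exact norm_fst_le p.1
      _ ≤ ‖x‖ * (C * ‖r‖) := by gcongr
      _ = _ := by ring)
  let v : R := (InnerProductSpace.toDual ℂ R).symm φ
  have hv : ∀ r, inner ℂ v r = φ r := fun r => InnerProductSpace.toDual_symm_apply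
  obtain ⟨z, hz⟩ := v.2
  have hz : T z = v := hz
  obtain ⟨h, h'⟩ := adj_mem hd (T z) x (by
    intro u
    have h1 := hv ⟨T u, u, rfl⟩
    have h2 : φ ⟨T u, u, rfl⟩ = inner ℂ x (u : E) := by
      change inner ℂ x (g ⟨T u, u, rfl⟩).1.1 = _
      exact hwd _ ⟨((u : E), T u), LinearPMap.mem_graph T u⟩ (by rw [hg']; rfl)
    rw [← h2, ← h1, hz]; rfl)
  exact ⟨z, h, h, h'⟩

end aux

/-- In a Hilbert complex with two closed-range operators `T₁ : H₁ → H₂` and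
`T₂ : H₂ → H₃` (closed, densely defined, `im T₁ ⊆ ker T₂`), the Laplacian
`Δ_T = T₁∘T₁† + T₂†∘T₂` on `H₂` has closed range. -/
theorem stmt5 {H₁ H₂ H₃ : Type*}
    [NormedAddCommGroup H₁] [InnerProductSpace ℂ H₁] [CompleteSpace H₁]
    [TopologicalSpace.SeparableSpace H₁]
    [NormedAddCommGroup H₂] [InnerProductSpace ℂ H₂] [CompleteSpace H₂]
    [TopologicalSpace.SeparableSpace H₂]
    [NormedAddCommGroup H₃] [InnerProductSpace ℂ H₃] [CompleteSpace H₃]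
    [TopologicalSpace.SeparableSpace H₃]
    (T₁ : H₁ →ₗ.[ℂ] H₂) (T₂ : H₂ →ₗ.[ℂ] H₃)
    (hd₁ : Dense (T₁.domain : Set H₁)) (hc₁ : T₁.IsClosed) (hr₁ : IsClosed (pran T₁))
    (hd₂ : Dense (T₂.domain : Set H₂)) (hc₂ : T₂.IsClosed) (hr₂ : IsClosed (pran T₂))
    (hcpx : pran T₁ ⊆ pker T₂) :
    IsClosed (pran (pcomp T₁ T₁.adjoint + pcomp T₂.adjoint T₂)) := by
  have hmem : ∀ y, y ∈ pran (pcomp T₁ T₁.adjoint + pcomp T₂.adjoint T₂) ↔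
      ∃ (s : H₂) (h1 : s ∈ T₁.adjoint.domain) (h1' : T₁.adjoint ⟨s, h1⟩ ∈ T₁.domain)
        (h2 : s ∈ T₂.domain) (h2' : T₂ ⟨s, h2⟩ ∈ T₂.adjoint.domain),
        T₁ ⟨_, h1'⟩ + T₂.adjoint ⟨_, h2'⟩ = y := by
    intro y
    constructor
    · rintro ⟨⟨s, hs⟩, rfl⟩
      obtain ⟨h1, h1'⟩ := (mem_pcomp_domain _ _ _).1 hs.1
      obtain ⟨h2, h2'⟩ := (mem_pcomp_domain _ _ _).1 hs.2
      refine ⟨s, h1, h1', h2, h2', ?_⟩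
      simp only [LinearPMap.add_apply]
      rw [pcomp_apply _ _ _ _ h1 h1', pcomp_apply _ _ _ _ h2 h2']
    · rintro ⟨s, h1, h1', h2, h2', rfl⟩
      refine ⟨⟨s, (mem_pcomp_domain _ _ _).2 ⟨h1, h1'⟩, (mem_pcomp_domain _ _ _).2 ⟨h2, h2'⟩⟩, ?_⟩
      simp only [LinearPMap.add_apply]
      rw [pcomp_apply _ _ _ _ h1 h1', pcomp_apply _ _ _ _ h2 h2']
  have fa1 := LinearPMap.adjoint_isFormalAdjoint hd₁
  have fa2 := LinearPMap.adjoint_isFormalAdjoint hd₂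
  let K : Submodule ℂ H₂ := kerS T₁.adjoint ⊓ kerS T₂
  have hEq : pran (pcomp T₁ T₁.adjoint + pcomp T₂.adjoint T₂) = (Kᗮ : Submodule ℂ H₂) := by
    ext y
    rw [hmem, SetLike.mem_coe]
    constructor
    · rintro ⟨s, h1, h1', h2, h2', rfl⟩
      rw [Submodule.mem_orthogonal]
      rintro k ⟨hk1, hk2⟩
      obtain ⟨k1, k1'⟩ := (mem_kerS _ _).1 hk1
      obtain ⟨k2, k2'⟩ := (mem_kerS _ _).1 hk2
      have e1 := fa1 ⟨k, k1⟩ ⟨_, h1'⟩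
      have e2 := fa2 ⟨_, h2'⟩ ⟨k, k2⟩
      rw [k1', inner_zero_left] at e1
      rw [k2', inner_zero_right] at e2
      rw [inner_add_right, ← e1, zero_add]
      exact inner_eq_zero_symm.1 e2
    · intro hy
      let R : Submodule ℂ H₂ := LinearMap.range T₁.toFun
      have hR : IsClosed (R : Set H₂) := hr₁
      haveI : CompleteSpace R := hR.completeSpace_coe
      haveI : CompleteSpace (kerS T₂) := (kerS_closed hc₂).completeSpace_coe
      have hRK : R ≤ kerS T₂ := fun x hx => (mem_kerS _ _).2 (hcpx hx)
      have hRp : ∀ b ∈ Rᗮ, ∃ h : b ∈ T₁.adjoint.domain, T₁.adjoint ⟨b, h⟩ = 0 := by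
        intro b hb
        refine adj_mem hd₁ b 0 fun x => ?_
        rw [inner_zero_left]
        exact ((Submodule.mem_orthogonal' _ _).1 hb _ ⟨x, rfl⟩).symm
      have hKR : (kerS T₂)ᗮ ≤ Rᗮ := Submodule.orthogonal_le hRK
      obtain ⟨a, ha, b, hb, rfl⟩ := R.exists_add_mem_mem_orthogonal y
      obtain ⟨c, hc, d, hd, rfl⟩ := (kerS T₂).exists_add_mem_mem_orthogonal b
      have hcR : c ∈ Rᗮ := by
        have := Rᗮ.sub_mem hb (hKR hd)
        simpa using this
      have hc0 : c = 0 := by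
        have h1 := (Submodule.mem_orthogonal _ _).1 hy c
          ⟨(mem_kerS _ _).2 (hRp c hcR), hc⟩
        have h2 := (Submodule.mem_orthogonal' _ _).1 hcR a ha
        have h3 := (Submodule.mem_orthogonal _ _).1 hd c hc
        rw [inner_add_right, inner_add_right, h2, h3, zero_add, add_zero] at h1
        exact inner_self_eq_zero.1 h1
      subst hc0
      obtain ⟨u, hu⟩ := ha
      obtain ⟨u', hu', hup⟩ := exists_perp hc₁ u
      obtain ⟨t, -, t1, t1'⟩ := crt hd₁ hc₁ hr₁ _ hup
      obtain ⟨z, -, z2, z2'⟩ := crt hd₂ hc₂ hr₂ d hd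
      obtain ⟨w, hw, hwp⟩ := exists_perp hc₂ z
      obtain ⟨w1, w1'⟩ := hRp _ (hKR hwp)
      obtain ⟨t2, t2'⟩ := hcpx ⟨t, rfl⟩
      have es1 : T₁.adjoint ⟨T₁ t + w, Submodule.add_mem _ t1 w1⟩ = (u' : H₁) := by
        have := LinearPMap.map_add T₁.adjoint ⟨T₁ t, t1⟩ ⟨w, w1⟩
        rw [t1', w1', add_zero] at this
        exact this
      have es2 : T₂ ⟨T₁ t + w, Submodule.add_mem _ t2 w.2⟩ = T₂ z := by
        have := LinearPMap.map_add T₂ ⟨T₁ t, t2⟩ w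
        rw [t2', zero_add, hw] at this
        exact this
      refine ⟨T₁ t + w, Submodule.add_mem _ t1 w1, by rw [es1]; exact u'.2,
        Submodule.add_mem _ t2 w.2, by rw [es2]; exact z2, ?_⟩
      simp only [es1, es2, z2', zero_add]
      rw [← hu]
      congr 1
  rw [hEq]
  exact K.isClosed_orthogonal

end Paper
end

section
/- Let T₁ : H₁ → H₂ and T₂ : H₂ → H₃ be closed densely defined operators between separable Hilbert spaces with closed ranges and im(T₁) ⊆ ker(T₂), and let Δ_T = T₁∘T₁* + T₂*∘T₂. Then the Green operator G_{Δ_T} : H₂ → H₂ is compact if and only if both Green operators G_{T₁*∘T₁} : H₁ → H₁ and G_{T₂∘T₂*} : H₃ → H₃ are compact. -/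
namespace Paper

open ContinuousLinearMap

theorem mem_pcomp_graph {E F G : Type*} [AddCommGroup E] [Module ℂ E]
    [AddCommGroup F] [Module ℂ F] [AddCommGroup G] [Module ℂ G]
    (S : F →ₗ.[ℂ] G) (T : E →ₗ.[ℂ] F) (x : E) (y : G) :
    (x, y) ∈ (pcomp S T).graph ↔ ∃ z, (x, z) ∈ T.graph ∧ (z, y) ∈ S.graph := by
  have key : ∀ (x : T.domain) (h : T x ∈ S.domain) (h' : (x : E) ∈ (pcomp S T).domain),
      (pcomp S T) ⟨x, h'⟩ = S ⟨T x, h⟩ := by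
    intro x h h'
    have : (Submodule.equivMapOfInjective T.domain.subtype
        (Submodule.injective_subtype T.domain)
        (S.domain.comap T.toFun)).symm ⟨x, h'⟩ = ⟨x, h⟩ := by
      rw [LinearEquiv.symm_apply_eq]
      rfl
    change S.toFun (LinearMap.codRestrict _ _ _ ((Submodule.equivMapOfInjective T.domain.subtype
        (Submodule.injective_subtype T.domain)
        (S.domain.comap T.toFun)).symm ⟨x, h'⟩)) = _
    rw [this]
    rfl
  constructor
  · intro h
    rw [LinearPMap.mem_graph_iff] at h
    obtain ⟨⟨a, ha⟩, h1, h2⟩ := h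
    obtain ⟨b, hb, rfl⟩ := ha
    simp only at h1 h2
    have hb' : T b ∈ S.domain := hb
    refine ⟨T b, ?_, ?_⟩
    · rw [← h1]; exact LinearPMap.mem_graph T b
    · rw [← h2]
      erw [key b hb']
      exact LinearPMap.mem_graph S ⟨T b, hb'⟩
  · rintro ⟨z, h1, h2⟩
    rw [LinearPMap.mem_graph_iff] at h1 h2
    obtain ⟨a, ha, rfl⟩ := h1
    obtain ⟨b, hb, rfl⟩ := h2
    simp only at ha hb
    subst ha
    have hb' : T a ∈ S.domain := hb ▸ b.2
    have hm : (a : E) ∈ (pcomp S T).domain := ⟨a, hb', rfl⟩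
    rw [LinearPMap.mem_graph_iff]
    refine ⟨⟨a, hm⟩, rfl, ?_⟩
    rw [key a hb' hm]
    congr 1
    exact Subtype.ext hb.symm

theorem mem_add_graph {E F : Type*} [AddCommGroup E] [Module ℂ E]
    [AddCommGroup F] [Module ℂ F] 
    (S : E →ₗ.[ℂ] F) (T : E →ₗ.[ℂ] F) (x : E) (y : F) :
    (x, y) ∈ (S + T).graph ↔ ∃ a b, (x, a) ∈ S.graph ∧ (x, b) ∈ T.graph ∧ a + b = y := by
  simp only [LinearPMap.mem_graph_iff]
  constructor
  · rintro ⟨⟨a, ha⟩, h1, h2⟩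
    simp only at h1 h2
    subst h1
    exact ⟨S ⟨a, ha.1⟩, T ⟨a, ha.2⟩, ⟨_, rfl, rfl⟩, ⟨_, rfl, rfl⟩, h2⟩
  · rintro ⟨_, _, ⟨a, ha, rfl⟩, ⟨b, hb, rfl⟩, rfl⟩
    subst ha
    refine ⟨⟨a, a.2, hb ▸ b.2⟩, rfl, ?_⟩
    rw [LinearPMap.add_apply]
    congr 2
    exact Subtype.ext hb.symm

section Helpers

variable {E F H : Type*} [NormedAddCommGroup E] [InnerProductSpace ℂ E] [CompleteSpace E]
  [NormedAddCommGroup F] [InnerProductSpace ℂ F] [CompleteSpace F]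
  [NormedAddCommGroup H] [InnerProductSpace ℂ H] [CompleteSpace H]

theorem compact_of_adj (A : E →L[ℂ] F) (h : IsCompactOperator ⇑(adjoint A ∘L A)) :
    IsCompactOperator ⇑A := by
  have h1 := h.isCompact_closure_image_closedBall (f := (adjoint A ∘L A : E →L[ℂ] E).toLinearMap) 1
  have h2 : TotallyBounded ((adjoint A ∘L A) '' Metric.closedBall (0 : E) 1) :=
    h1.totallyBounded.subset subset_closure
  refine (isCompactOperator_iff_isCompact_closure_image_closedBall (A : E →ₗ[ℂ] F) one_pos).2 ?_
  apply TotallyBounded.isCompact_of_isClosed _ isClosed_closure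
  apply TotallyBounded.closure
  rw [Metric.totallyBounded_iff]
  intro ε hε
  obtain ⟨t, hts, htf, hcov⟩ := Metric.finite_approx_of_totallyBounded h2 (ε ^ 2 / 2) (by positivity)
  obtain ⟨t', ht's, ht'f, rfl⟩ := Set.exists_subset_image_finite_and.1 ⟨t, hts, htf, rfl⟩
  refine ⟨A '' t', ht'f.image _, ?_⟩
  rintro _ ⟨x, hx, rfl⟩
  have hx' := hcov ⟨x, hx, rfl⟩
  simp only [Set.mem_iUnion, Set.mem_image] at hx' ⊢
  obtain ⟨_, ⟨y, hy, rfl⟩, hxy⟩ := hx'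
  refine ⟨_, ⟨y, hy, rfl⟩, ?_⟩
  rw [Metric.mem_ball, dist_eq_norm] at hxy ⊢
  have e1 : ‖A (x - y)‖ ^ 2 ≤ ‖(adjoint A ∘L A) (x - y)‖ * ‖x - y‖ := by
    rw [apply_norm_sq_eq_inner_adjoint_left]
    exact (Complex.re_le_norm _).trans (norm_inner_le_norm _ _)
  have e2 : ‖x - y‖ ≤ 2 := by
    have a1 : ‖x‖ ≤ 1 := by simpa using hx
    have a2 : ‖y‖ ≤ 1 := by simpa using ht's hy
    linarith [norm_sub_le x y]
  rw [← map_sub] at hxy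
  have e3 : ‖A (x - y)‖ ^ 2 < ε ^ 2 := by
    nlinarith [norm_nonneg ((adjoint A ∘L A) (x - y))]
  have := lt_of_pow_lt_pow_left₀ 2 hε.le e3
  simpa using this

structure MP (T : E →ₗ.[ℂ] F) (T' : F →ₗ.[ℂ] E) (A : F →L[ℂ] E) (P : F →L[ℂ] F)
    (Q : E →L[ℂ] E) : Prop where
  hA : ∀ u, (A u, P u) ∈ T.graph
  hA' : ∀ x, (adjoint A x, Q x) ∈ T'.graph
  l : ∀ x y, (x, y) ∈ T.graph → A y = Q x
  l' : ∀ z w, (z, w) ∈ T'.graph → adjoint A w = P z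
  r : ∀ x y, (x, y) ∈ T.graph → P y = y
  r' : ∀ z w, (z, w) ∈ T'.graph → Q w = w
  k : ∀ x, (x - Q x, 0) ∈ T.graph
  k' : ∀ x, (x - P x, 0) ∈ T'.graph
  AP : ∀ u, A (P u) = A u
  AP' : ∀ u, adjoint A (Q u) = adjoint A u
  sP : ∀ x y, inner ℂ (P x) y = inner ℂ x (P y)
  sQ : ∀ x y, inner ℂ (Q x) y = inner ℂ x (Q y)

theorem MP.swap {T : E →ₗ.[ℂ] F} {T' : F →ₗ.[ℂ] E} {A P Q} (h : MP T T' A P Q) :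
    MP T' T (adjoint A) Q P := by
  constructor <;> (try rw [adjoint_adjoint])
  exacts [h.hA', h.hA, h.l', h.l, h.r', h.r, h.k', h.k, h.AP', h.AP, h.sQ, h.sP]

theorem MP.QA {T : E →ₗ.[ℂ] F} {T' : F →ₗ.[ℂ] E} {A P Q} (h : MP T T' A P Q) (u) :
    Q (A u) = A u := by
  rw [← h.l _ _ (h.hA u), h.AP]

theorem MP.PA {T : E →ₗ.[ℂ] F} {T' : F →ₗ.[ℂ] E} {A P Q} (h : MP T T' A P Q) (u) :
    P (adjoint A u) = adjoint A u := h.swap.QA u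

theorem MP.QQ {T : E →ₗ.[ℂ] F} {T' : F →ₗ.[ℂ] E} {A P Q} (h : MP T T' A P Q) (u) :
    Q (Q u) = Q u := h.r' _ _ (h.hA' u)

theorem MP.PP {T : E →ₗ.[ℂ] F} {T' : F →ₗ.[ℂ] E} {A P Q} (h : MP T T' A P Q) (u) :
    P (P u) = P u := h.swap.QQ u

theorem MP.mk_self {S : E →ₗ.[ℂ] E} {K R : E →L[ℂ] E} (hK : adjoint K = K)
    (hA : ∀ u, (K u, R u) ∈ S.graph)
    (l : ∀ x y, (x, y) ∈ S.graph → K y = R x)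
    (r : ∀ x y, (x, y) ∈ S.graph → R y = y)
    (k : ∀ x, (x - R x, 0) ∈ S.graph)
    (AP : ∀ u, K (R u) = K u)
    (s : ∀ x y, inner ℂ (R x) y = inner ℂ x (R y)) : MP S S K R R := by
  constructor <;> (try rw [hK]) <;> assumption

theorem MP.dense {S : E →ₗ.[ℂ] E} {K R : E →L[ℂ] E} (hK : adjoint K = K)
    (h : MP S S K R R) : Dense (S.domain : Set E) := by
  rw [Submodule.dense_iff_topologicalClosure_eq_top,
    Submodule.topologicalClosure_eq_top_iff, Submodule.eq_bot_iff]
  intro x hx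
  rw [Submodule.mem_orthogonal] at hx
  have h1 : K x = 0 := by
    rw [← inner_self_eq_zero (𝕜 := ℂ)]
    conv_lhs => rw [← hK]
    rw [adjoint_inner_left, ← inner_conj_symm]
    rw [hK]
    have := hx _ (LinearPMap.mem_domain_of_mem_graph (h.hA (K x)))
    rw [this]; simp
  have h2 := h.hA x
  rw [h1] at h2
  have h3 : R x = 0 := S.graph_fst_eq_zero_snd h2 rfl
  have h4 := h.k x
  rw [h3, sub_zero] at h4
  exact inner_self_eq_zero.1 (hx _ (LinearPMap.mem_domain_of_mem_graph h4))

theorem green_unique {S : E →ₗ.[ℂ] E} {K R : E →L[ℂ] E} (hK : adjoint K = K)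
    (h : MP S S K R R) {G : E →L[ℂ] E} (hG : IsGreen S G) : G = K := by
  have hd := h.dense hK
  ext u
  have h0 : G (u - R u) = 0 := by
    have hin : ∀ x : S.domain, inner ℂ (0 : E) x = inner ℂ (u - R u) (S x) := by
      intro x
      rw [← h.r _ _ (S.mem_graph x), ← h.sP, map_sub, h.PP, sub_self, inner_zero_left,
        inner_zero_left]
    have hm := LinearPMap.mem_adjoint_domain_of_exists (T := S) (u - R u) ⟨0, hin⟩
    exact hG.1 ⟨_, hm⟩ (LinearPMap.adjoint_apply_eq hd _ hin)
  have h1 : G (R u) = G u := by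
    rw [map_sub, sub_eq_zero] at h0; exact h0.symm
  obtain ⟨a, ha, hb⟩ := (LinearPMap.mem_graph_iff S).1 (h.hA u)
  simp only at ha hb
  obtain ⟨hg, ⟨w, hw⟩, hs⟩ := hG.2 a
  have h2 : (G (S a), S a) ∈ S.graph := by
    have := S.mem_graph ⟨_, hg⟩
    rwa [hs] at this
  rw [hb, h1] at h2
  simp only [hb, h1] at hw
  have h3 := h.l _ _ h2
  rw [h.AP] at h3
  rw [h3]
  apply (ext_inner_right ℂ _)
  intro v
  rw [h.sP, ← sub_eq_zero, ← inner_sub_right, ← hw]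
  obtain ⟨b, hb1, hb2⟩ := (LinearPMap.mem_graph_iff S).1 (h.k v)
  simp only at hb1 hb2
  have := LinearPMap.adjoint_isFormalAdjoint hd w b
  rw [hb1, hb2, inner_zero_right] at this
  exact this

theorem adj_comp_self (A : F →L[ℂ] E) : adjoint (A ∘L adjoint A) = A ∘L adjoint A := by
  rw [adjoint_comp, adjoint_adjoint]

theorem MP.comp {T : E →ₗ.[ℂ] F} {T' : F →ₗ.[ℂ] E} {A P Q} (h : MP T T' A P Q) :
    MP (pcomp T' T) (pcomp T' T) (A ∘L adjoint A) Q Q := by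
  apply MP.mk_self (adj_comp_self A)
  · intro u
    rw [mem_pcomp_graph]
    refine ⟨adjoint A u, ?_, h.hA' u⟩
    have := h.hA (adjoint A u)
    rwa [h.PA] at this
  · intro x y hxy
    rw [mem_pcomp_graph] at hxy
    obtain ⟨z, h1, h2⟩ := hxy
    rw [comp_apply, h.l' _ _ h2, h.AP, h.l _ _ h1]
  · intro x y hxy
    rw [mem_pcomp_graph] at hxy
    obtain ⟨z, h1, h2⟩ := hxy
    exact h.r' _ _ h2
  · intro x
    rw [mem_pcomp_graph]
    exact ⟨0, h.k x, T'.graph.zero_mem⟩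
  · intro u
    rw [comp_apply, h.AP', comp_apply]
  · exact h.sQ

theorem MP.lap {T₁ : E →ₗ.[ℂ] F} {T₁' : F →ₗ.[ℂ] E} {A₁ P₁ Q₁} (h₁ : MP T₁ T₁' A₁ P₁ Q₁)
    {T₂ : F →ₗ.[ℂ] H} {T₂' : H →ₗ.[ℂ] F} {A₂ P₂ Q₂} (h₂ : MP T₂ T₂' A₂ P₂ Q₂)
    (hK : adjoint (adjoint A₁ ∘L A₁ + A₂ ∘L adjoint A₂) = adjoint A₁ ∘L A₁ + A₂ ∘L adjoint A₂)
    (e1 : ∀ x, Q₂ (P₁ x) = 0) (e2 : ∀ x, P₁ (Q₂ x) = 0) :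
    MP (pcomp T₁ T₁' + pcomp T₂' T₂) (pcomp T₁ T₁' + pcomp T₂' T₂)
      (adjoint A₁ ∘L A₁ + A₂ ∘L adjoint A₂) (P₁ + Q₂) (P₁ + Q₂) := by
  have k1 : ∀ x, (Q₂ x, (0 : E)) ∈ T₁'.graph := fun x => by
    have := h₁.k' (Q₂ x)
    rwa [e2, sub_zero] at this
  have k2 : ∀ x, (P₁ x, (0 : H)) ∈ T₂.graph := fun x => by
    have := h₂.k (P₁ x)
    rwa [e1, sub_zero] at this
  have a1 : ∀ x, A₁ (Q₂ x) = 0 := fun x => by rw [← h₁.AP, e2, map_zero]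
  have a2 : ∀ x, adjoint A₂ (P₁ x) = 0 := fun x => by rw [← h₂.AP', e1, map_zero]
  apply MP.mk_self hK
  · intro u
    rw [mem_add_graph]
    refine ⟨P₁ u, Q₂ u, ?_, ?_, rfl⟩
    · rw [mem_pcomp_graph]
      refine ⟨A₁ u, ?_, h₁.hA u⟩
      have := T₁'.graph.add_mem (h₁.hA' (A₁ u)) (k1 (A₂ (adjoint A₂ u)))
      rw [h₁.QA, h₂.QA] at this
      simpa using this
    · rw [mem_pcomp_graph]
      refine ⟨adjoint A₂ u, ?_, h₂.hA' u⟩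
      have := T₂.graph.add_mem (k2 (adjoint A₁ (A₁ u))) (h₂.hA (adjoint A₂ u))
      rw [h₁.PA, h₂.PA] at this
      simpa using this
  · intro x y hxy
    rw [mem_add_graph] at hxy
    obtain ⟨y1, y2, hy1, hy2, rfl⟩ := hxy
    rw [mem_pcomp_graph] at hy1 hy2
    obtain ⟨z1, hz1, hy1⟩ := hy1
    obtain ⟨z2, hz2, hy2⟩ := hy2
    have b1 : A₁ y2 = 0 := by rw [← h₂.r' _ _ hy2, a1]
    have b2 : adjoint A₂ y1 = 0 := by rw [← h₁.r _ _ hy1, a2]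
    simp only [add_apply, comp_apply, map_add, b1, b2, h₁.l _ _ hy1, h₁.AP', h₁.l' _ _ hz1,
      h₂.l' _ _ hy2, h₂.AP, h₂.l _ _ hz2, map_zero, add_zero, zero_add]
  · intro x y hxy
    rw [mem_add_graph] at hxy
    obtain ⟨y1, y2, hy1, hy2, rfl⟩ := hxy
    rw [mem_pcomp_graph] at hy1 hy2
    obtain ⟨z1, hz1, hy1⟩ := hy1
    obtain ⟨z2, hz2, hy2⟩ := hy2
    have b1 : P₁ y2 = 0 := by rw [← h₂.r' _ _ hy2, e2]
    have b2 : Q₂ y1 = 0 := by rw [← h₁.r _ _ hy1, e1]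
    simp only [add_apply, map_add, b1, b2, h₁.r _ _ hy1, h₂.r' _ _ hy2, add_zero, zero_add]
  · intro x
    rw [mem_add_graph]
    refine ⟨0, 0, ?_, ?_, add_zero 0⟩
    · rw [mem_pcomp_graph]
      refine ⟨0, ?_, T₁.graph.zero_mem⟩
      have := T₁'.graph.sub_mem (h₁.k' x) (k1 x)
      simpa [sub_sub] using this
    · rw [mem_pcomp_graph]
      refine ⟨0, ?_, T₂'.graph.zero_mem⟩
      have := T₂.graph.sub_mem (h₂.k x) (k2 x)
      simpa [sub_sub, add_comm] using this
  · intro u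
    simp only [add_apply, comp_apply, map_add, a1, a2, h₁.AP, h₂.AP', map_zero, add_zero, zero_add]
  · intro x y
    simp only [add_apply, inner_add_left, inner_add_right, h₁.sP, h₂.sQ]

theorem MP.exists (T : E →ₗ.[ℂ] F) (hd : Dense (T.domain : Set E)) (hc : T.IsClosed)
    (hr : IsClosed (pran T)) : ∃ A P Q, MP T T.adjoint A P Q := by
  have hcl : IsClosed (T.graph : Set (E × F)) := hc
  let N : Submodule ℂ E := T.graph.comap (LinearMap.inl ℂ E F)
  have hN : ∀ x, x ∈ N ↔ (x, (0 : F)) ∈ T.graph := fun x => Iff.rfl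
  have hNc : IsClosed (N : Set E) :=
    hcl.preimage (f := fun x : E => (x, (0 : F))) (by fun_prop)
  let M : Submodule ℂ F := LinearMap.range T.toFun
  have hMc : IsClosed (M : Set F) := by
    have e : (M : Set F) = pran T := LinearMap.coe_range T.toFun
    rw [e]; exact hr
  have hM : ∀ y, y ∈ M ↔ ∃ x, (x, y) ∈ T.graph := by
    intro y
    constructor
    · rintro ⟨x, rfl⟩
      exact ⟨x, T.mem_graph x⟩
    · rintro ⟨x, hx⟩
      obtain ⟨a, ha, hb⟩ := (LinearPMap.mem_graph_iff T).1 hx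
      exact ⟨a, hb⟩
  have : CompleteSpace N := hNc.completeSpace_coe
  have : CompleteSpace M := hMc.completeSpace_coe
  let P : F →L[ℂ] F := M.starProjection
  let Q : E →L[ℂ] E := ContinuousLinearMap.id ℂ E - N.starProjection
  have hQ : ∀ x, Q x = x - N.starProjection x := fun x => rfl
  have hQN : ∀ x ∈ N, Q x = 0 := fun x hx => by
    rw [hQ, Submodule.starProjection_eq_self_iff.2 hx, sub_self]
  have hQp : ∀ x, (∀ n ∈ N, inner ℂ n x = 0) → Q x = x := fun x hx => by
    rw [hQ, (Submodule.starProjection_apply_eq_zero_iff N).2 ((Submodule.mem_orthogonal _ _).2 hx),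
      sub_zero]
  have hk : ∀ x, (x - Q x, (0 : F)) ∈ T.graph := fun x => by
    rw [hQ, sub_sub_cancel, ← hN]
    exact Submodule.starProjection_apply_mem N x
  have hQQ : ∀ x, Q (Q x) = Q x := fun x => by
    have := hQN _ ((hN _).2 (hk x))
    rw [map_sub, sub_eq_zero] at this
    exact this.symm
  have hPM : ∀ y, P y ∈ M := fun y => Submodule.starProjection_apply_mem M y
  have hPe : ∀ y ∈ M, P y = y := fun y hy => Submodule.starProjection_eq_self_iff.2 hy
  have hsP : ∀ x y, inner ℂ (P x) y = inner ℂ x (P y) := fun x y =>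
    Submodule.inner_starProjection_left_eq_right M x y
  have hsQ : ∀ x y, inner ℂ (Q x) y = inner ℂ x (Q y) := fun x y => by
    rw [hQ, hQ, inner_sub_left, inner_sub_right, Submodule.inner_starProjection_left_eq_right]
  have huniq : ∀ x x' y, (x, y) ∈ T.graph → (x', y) ∈ T.graph → Q x = Q x' := by
    intro x x' y h h'
    have := T.graph.sub_mem h h'
    simp only [Prod.mk_sub_mk, sub_self] at this
    have := hQN _ ((hN _).2 this)
    rwa [map_sub, sub_eq_zero] at this
  have hex : ∀ u, ∃ x, (x, P u) ∈ T.graph ∧ Q x = x := by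
    intro u
    obtain ⟨x, hx⟩ := (hM _).1 (hPM u)
    refine ⟨Q x, ?_, hQQ x⟩
    have := T.graph.sub_mem hx (hk x)
    simpa using this
  choose f hf1 hf2 using hex
  have hfu : ∀ u x, (x, P u) ∈ T.graph → f u = Q x := fun u x hx => by
    rw [← hf2, huniq _ _ _ (hf1 u) hx]
  let f' : F →ₗ[ℂ] E :=
    { toFun := f
      map_add' := fun u v => by
        rw [hfu (u + v) (f u + f v), map_add, hf2, hf2]
        have := T.graph.add_mem (hf1 u) (hf1 v)
        simpa using this
      map_smul' := fun c u => by
        rw [hfu (c • u) (c • f u), map_smul, hf2]; rfl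
        have := T.graph.smul_mem c (hf1 u)
        simpa using this }
  have hgr : IsClosed (f'.graph : Set (F × E)) := by
    have : (f'.graph : Set (F × E)) =
        {p | (p.2, P p.1) ∈ T.graph} ∩ {p | Q p.2 = p.2} := by
      ext ⟨u, x⟩
      simp only [SetLike.mem_coe, LinearMap.mem_graph_iff, Set.mem_inter_iff, Set.mem_ofPred_eq]
      constructor
      · rintro rfl
        exact ⟨hf1 u, hf2 u⟩
      · rintro ⟨h1, h2⟩
        rw [← h2]
        exact (hfu u x h1).symm
    rw [this]
    exact (hcl.preimage (f := fun p : F × E => (p.2, P p.1)) (by fun_prop)).inter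
      (isClosed_eq (by fun_prop) (by fun_prop))
  let A : F →L[ℂ] E := ⟨f', f'.continuous_of_isClosed_graph hgr⟩
  have hA : ∀ u, (A u, P u) ∈ T.graph := hf1
  have hQA : ∀ u, Q (A u) = A u := hf2
  have hr' : ∀ x y, (x, y) ∈ T.graph → P y = y := fun x y h => hPe y ((hM y).2 ⟨x, h⟩)
  have hl : ∀ x y, (x, y) ∈ T.graph → A y = Q x := fun x y h => hfu y x (by rwa [hr' x y h])
  have hPP : ∀ y, P (P y) = P y := fun y => hPe _ (hPM y)
  have hAP : ∀ u, A (P u) = A u := fun u => by rw [hl _ _ (hA u), hQA]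
  have hfa : ∀ x y z w, (x, y) ∈ T.graph → (z, w) ∈ T.adjoint.graph →
      inner ℂ w x = inner ℂ z y := by
    intro x y z w h h'
    obtain ⟨a, ha, hb⟩ := (LinearPMap.mem_graph_iff _).1 h
    obtain ⟨c, hc1, hc2⟩ := (LinearPMap.mem_graph_iff _).1 h'
    simp only at ha hb hc1 hc2
    have := LinearPMap.adjoint_isFormalAdjoint hd c a
    rwa [ha, hb, hc1, hc2] at this
  have hmk : ∀ z w, (∀ x y, (x, y) ∈ T.graph → inner ℂ w x = inner ℂ z y) →
      (z, w) ∈ T.adjoint.graph := by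
    intro z w h
    have h' : ∀ x : T.domain, inner ℂ w (x : E) = inner ℂ z (T x) := fun x => h _ _ (T.mem_graph x)
    have hm := LinearPMap.mem_adjoint_domain_of_exists (T := T) z ⟨w, h'⟩
    exact (LinearPMap.mem_graph_iff _).2 ⟨⟨z, hm⟩, rfl, LinearPMap.adjoint_apply_eq hd _ h'⟩
  refine ⟨A, P, Q, hA, ?_, hl, ?_, hr', ?_, hk, ?_, hAP, ?_, hsP, hsQ⟩
  · intro x
    apply hmk
    intro a b hab
    rw [adjoint_inner_left, hl _ _ hab, hsQ]
  · intro z w h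
    apply ext_inner_right ℂ
    intro v
    rw [adjoint_inner_left, hsP]
    exact hfa _ _ _ _ (hA v) h
  · intro z w h
    apply hQp
    intro n hn
    rw [← inner_conj_symm, hfa _ _ _ _ ((hN n).1 hn) h]
    simp
  · intro z
    apply hmk
    intro x y h
    rw [← hr' _ _ h, ← hsP, map_sub, hPP, sub_self]
    simp
  · intro u
    apply ext_inner_right ℂ
    intro v
    rw [adjoint_inner_left, adjoint_inner_left, hsQ, hQA]

end Helpers

/-- Let `T₁ : H₁ → H₂`, `T₂ : H₂ → H₃` be closed densely defined operators with
closed ranges and `im T₁ ⊆ ker T₂`, and `Δ_T = T₁∘T₁† + T₂†∘T₂`.  Then the Green operator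
`G_{Δ_T}` is compact if and only if both `G_{T₁†∘T₁}` and `G_{T₂∘T₂†}` are compact. -/
theorem stmt6 {H₁ H₂ H₃ : Type*}
    [NormedAddCommGroup H₁] [InnerProductSpace ℂ H₁] [CompleteSpace H₁]
    [TopologicalSpace.SeparableSpace H₁]
    [NormedAddCommGroup H₂] [InnerProductSpace ℂ H₂] [CompleteSpace H₂]
    [TopologicalSpace.SeparableSpace H₂]
    [NormedAddCommGroup H₃] [InnerProductSpace ℂ H₃] [CompleteSpace H₃]
    [TopologicalSpace.SeparableSpace H₃]
    (T₁ : H₁ →ₗ.[ℂ] H₂) (T₂ : H₂ →ₗ.[ℂ] H₃)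
    (hd₁ : Dense (T₁.domain : Set H₁)) (hc₁ : T₁.IsClosed) (hr₁ : IsClosed (pran T₁))
    (hd₂ : Dense (T₂.domain : Set H₂)) (hc₂ : T₂.IsClosed) (hr₂ : IsClosed (pran T₂))
    (hcpx : pran T₁ ⊆ pker T₂)
    (G : H₂ →L[ℂ] H₂) (hG : IsGreen (pcomp T₁ T₁.adjoint + pcomp T₂.adjoint T₂) G)
    (G₁ : H₁ →L[ℂ] H₁) (hG₁ : IsGreen (pcomp T₁.adjoint T₁) G₁)
    (G₃ : H₃ →L[ℂ] H₃) (hG₃ : IsGreen (pcomp T₂ T₂.adjoint) G₃) :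
    IsCompactOperator ⇑G ↔ IsCompactOperator ⇑G₁ ∧ IsCompactOperator ⇑G₃ := by
  obtain ⟨A₁, P₁, Q₁, h₁⟩ := MP.exists T₁ hd₁ hc₁ hr₁
  obtain ⟨A₂, P₂, Q₂, h₂⟩ := MP.exists T₂ hd₂ hc₂ hr₂
  have e1 : ∀ x, Q₂ (P₁ x) = 0 := by
    intro x
    obtain ⟨a, -, ha⟩ := (LinearPMap.mem_graph_iff _).1 (h₁.hA x)
    simp only at ha
    obtain ⟨h, h'⟩ := hcpx ⟨a, ha⟩
    have : (P₁ x, (0 : H₃)) ∈ T₂.graph := (LinearPMap.mem_graph_iff _).2 ⟨⟨_, h⟩, rfl, h'⟩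
    rw [← h₂.l _ _ this, map_zero]
  have e2 : ∀ x, P₁ (Q₂ x) = 0 := by
    intro x
    apply ext_inner_right ℂ
    intro v
    rw [h₁.sP, h₂.sQ, e1]
    simp
  have hK : adjoint (adjoint A₁ ∘L A₁ + A₂ ∘L adjoint A₂) =
      adjoint A₁ ∘L A₁ + A₂ ∘L adjoint A₂ := by
    rw [map_add, adjoint_comp, adjoint_comp, adjoint_adjoint, adjoint_adjoint]
  have g : G = adjoint A₁ ∘L A₁ + A₂ ∘L adjoint A₂ :=
    green_unique hK (h₁.lap h₂ hK e1 e2) hG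
  have g1 : G₁ = A₁ ∘L adjoint A₁ := green_unique (adj_comp_self A₁) h₁.comp hG₁
  have g3 : G₃ = adjoint A₂ ∘L A₂ := by
    have := green_unique (adj_comp_self (adjoint A₂)) h₂.swap.comp hG₃
    rwa [adjoint_adjoint] at this
  have z1 : ∀ x, A₁ (A₂ x) = 0 := fun x => by
    rw [← h₂.QA, ← h₁.AP, e2, map_zero]
  have z2 : ∀ x, adjoint A₂ (adjoint A₁ x) = 0 := fun x => by
    rw [← h₁.PA, ← h₂.AP', e1, map_zero]
  constructor
  · intro hc
    constructor
    · have c1 : IsCompactOperator ⇑(adjoint (A₁ ∘L adjoint A₁) ∘L (A₁ ∘L adjoint A₁)) := by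
        have := (hc.clm_comp A₁).comp_clm (adjoint A₁)
        refine (congrArg IsCompactOperator (funext fun x => ?_)).mp this
        simp [g, z1, z2, adjoint_comp]
      rw [g1]
      exact compact_of_adj _ c1
    · have c1 : IsCompactOperator ⇑(adjoint (adjoint A₂ ∘L A₂) ∘L (adjoint A₂ ∘L A₂)) := by
        have := (hc.clm_comp (adjoint A₂)).comp_clm A₂
        refine (congrArg IsCompactOperator (funext fun x => ?_)).mp this
        simp [g, z1, z2, adjoint_comp]
      rw [g3]
      exact compact_of_adj _ c1
  · rintro ⟨c1, c3⟩
    rw [g1] at c1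
    rw [g3] at c3
    have d1 : IsCompactOperator ⇑(adjoint A₁) := compact_of_adj _ (by rwa [adjoint_adjoint])
    have d3 : IsCompactOperator ⇑A₂ := compact_of_adj _ c3
    rw [g]
    exact (d1.comp_clm A₁).add (d3.comp_clm (adjoint A₂))

end Paper
end
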